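/- arXiv:2504.16413 — 3 statements merged into one kernel-verified Lean document; each statement's English description precedes it below -/
import Mathlib

section
/- Let N ≥ 2. Let V ∈ ℝ^{(N−1)×N} satisfy V𝟙_N = 0 and rank V = N−1; let q ∈ ℝ^N satisfy qᵀ𝟙_N = 1; and let W ∈ ℝ^{N×(N−1)} satisfy qᵀW = 0 and rank W = N−1 (so that VW is invertible). Define V⁺ := W(VW)⁻¹. Then V⁺V = I_N − 𝟙_N qᵀ. -/
open Matrix

/-- Rank-nullity for matrices. -/
lemma Matrix.rank_add_finrank_ker_mulVecLin {K m n : Type*} [Field K] [Fintype m] [Fintype n]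
    (A : Matrix m n K) :
    A.rank + Module.finrank K (LinearMap.ker A.mulVecLin) = Fintype.card n := by
  simpa [Matrix.rank] using A.mulVecLin.finrank_range_add_finrank_ker

/-- If `A` has corank one and kills `u`, and `q ⬝ᵥ u = 1`, then the kernel of `A` is spanned by
`u`, with coordinate functional `q`. -/
lemma Matrix.eq_dotProduct_smul_of_mulVec_eq_zero {K m n : Type*} [Field K] [Fintype m]
    [Fintype n] {A : Matrix m n K} {u q x : n → K} (hA : A.rank + 1 = Fintype.card n)
    (hu : A *ᵥ u = 0) (hq : q ⬝ᵥ u = 1) (hx : A *ᵥ x = 0) : x = (q ⬝ᵥ x) • u := by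
  have hker : Module.finrank K (LinearMap.ker A.mulVecLin) = 1 := by
    have := A.rank_add_finrank_ker_mulVecLin
    omega
  have hu0 : (⟨u, hu⟩ : LinearMap.ker A.mulVecLin) ≠ 0 := by
    intro h
    have : u = 0 := congrArg Subtype.val h
    simp [this] at hq
  obtain ⟨c, hc⟩ := (finrank_eq_one_iff_of_nonzero' _ hu0).1 hker ⟨x, hx⟩
  have hcx : c • u = x := congrArg Subtype.val hc
  rw [← hcx, dotProduct_smul, hq, smul_eq_mul, mul_one]

/-- A matrix of full column rank acts injectively. -/
lemma Matrix.mulVec_eq_zero_of_rank_eq_card {K m n : Type*} [Field K] [Fintype m] [Fintype n]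
    {A : Matrix m n K} (hA : A.rank = Fintype.card n) {x : n → K} (hx : A *ᵥ x = 0) : x = 0 := by
  have hker : Module.finrank K (LinearMap.ker A.mulVecLin) = 0 := by
    have := A.rank_add_finrank_ker_mulVecLin
    omega
  have hmem : x ∈ LinearMap.ker A.mulVecLin := hx
  rwa [Submodule.finrank_eq_zero.1 hker, Submodule.mem_bot] at hmem

/-- core of Lemma 1: Under the spanning-tree incidence hypotheses,
the generalized inverse `V⁺ := W(VW)⁻¹` induced by `q` satisfies
`V⁺V = I_N − 𝟙_N qᵀ`. -/
theorem stmt13 (N : ℕ) (hN : 2 ≤ N)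
    (V : Matrix (Fin (N - 1)) (Fin N) ℝ)
    (hV1 : V.mulVec (fun _ => (1 : ℝ)) = 0) (hV2 : V.rank = N - 1)
    (q : Fin N → ℝ) (hq : q ⬝ᵥ (fun _ => (1 : ℝ)) = 1)
    (W : Matrix (Fin N) (Fin (N - 1)) ℝ)
    (hW1 : Matrix.vecMul q W = 0) (hW2 : W.rank = N - 1) :
    W * (V * W)⁻¹ * V = 1 - vecMulVec (fun _ => (1 : ℝ)) q := by
  have hrank : V.rank + 1 = Fintype.card (Fin N) := by
    rw [Fintype.card_fin]
    omega
  have hunit : IsUnit (V * W).det := by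
    rw [isUnit_iff_ne_zero]
    intro hdet
    obtain ⟨y, hy0, hy⟩ := exists_mulVec_eq_zero_iff.2 hdet
    rw [← mulVec_mulVec] at hy
    have hWy := eq_dotProduct_smul_of_mulVec_eq_zero hrank hV1 hq hy
    rw [dotProduct_mulVec, hW1, zero_dotProduct, zero_smul] at hWy
    exact hy0 (mulVec_eq_zero_of_rank_eq_card (by simpa using hW2) hWy)
  refine ext_of_mulVec_single fun i => ?_
  generalize (Pi.single i 1 : Fin N → ℝ) = x
  have hker : V *ᵥ ((W * (V * W)⁻¹ * V) *ᵥ x - x) = 0 := by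
    rw [mulVec_sub, mulVec_mulVec, ← Matrix.mul_assoc, ← Matrix.mul_assoc, mul_nonsing_inv _ hunit,
      Matrix.one_mul, sub_self]
  have hx := eq_dotProduct_smul_of_mulVec_eq_zero hrank hV1 hq hker
  have hqx : q ⬝ᵥ ((W * (V * W)⁻¹ * V) *ᵥ x) = 0 := by
    rw [dotProduct_mulVec, Matrix.mul_assoc, ← vecMul_vecMul, hW1, zero_vecMul, zero_dotProduct]
  rw [dotProduct_sub, hqx, zero_sub, sub_eq_iff_eq_add] at hx
  rw [hx, sub_mulVec, one_mulVec, vecMulVec_mulVec, op_smul_eq_smul, neg_smul]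
  abel
end

section
/- Let N ≥ 2. Let V ∈ ℝ^{(N−1)×N} satisfy V𝟙_N = 0 and rank V = N−1. Let q₁, q₂ ∈ ℝ^N satisfy q₁ᵀ𝟙_N = 1 and q₂ᵀ𝟙_N = 1, and let W₁, W₂ ∈ ℝ^{N×(N−1)} satisfy q₁ᵀW₁ = 0, q₂ᵀW₂ = 0, and rank W₁ = rank W₂ = N−1. Define V₁⁺ := W₁(VW₁)⁻¹ and V₂⁺ := W₂(VW₂)⁻¹. Then q₁ᵀ V₂⁺ = − q₂ᵀ V₁⁺. -/
open Matrix

namespace Matrix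

variable {m n : Type*} [Fintype n]

theorem finrank_ker_mulVecLin_add_rank (A : Matrix m n ℝ) :
    A.rank + Module.finrank ℝ (LinearMap.ker A.mulVecLin) = Fintype.card n := by
  simpa [Matrix.rank] using A.mulVecLin.finrank_range_add_finrank_ker

theorem exists_eq_smul_of_mulVec_eq_zero {V : Matrix m n ℝ} {u x : n → ℝ}
    (hrank : V.rank + 1 = Fintype.card n) (hu : u ≠ 0) (hVu : V *ᵥ u = 0)
    (hVx : V *ᵥ x = 0) : ∃ c : ℝ, x = c • u := by
  have hker : Module.finrank ℝ (LinearMap.ker V.mulVecLin) = 1 := by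
    have := V.finrank_ker_mulVecLin_add_rank
    omega
  obtain ⟨c, hc⟩ := (finrank_eq_one_iff_of_nonzero'
    (⟨u, hVu⟩ : LinearMap.ker V.mulVecLin) fun h => hu (congrArg Subtype.val h)).1 hker ⟨x, hVx⟩
  exact ⟨c, (congrArg Subtype.val hc).symm⟩

theorem eq_zero_of_mulVec_eq_zero_of_rank_eq_card {W : Matrix m n ℝ} {x : n → ℝ}
    (hrank : W.rank = Fintype.card n) (hWx : W *ᵥ x = 0) : x = 0 := by
  have hker : Module.finrank ℝ (LinearMap.ker W.mulVecLin) = 0 := by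
    have := W.finrank_ker_mulVecLin_add_rank
    omega
  have hx : x ∈ LinearMap.ker W.mulVecLin := hWx
  rwa [Submodule.finrank_eq_zero.1 hker, Submodule.mem_bot] at hx

variable [Fintype m] [DecidableEq m]

theorem mul_mul_inv_mul_eq_one {V : Matrix m n ℝ} {W : Matrix n m ℝ} {q u : n → ℝ}
    (hV : V.rank + 1 = Fintype.card n) (hVu : V *ᵥ u = 0) (hqu : q ⬝ᵥ u = 1)
    (hqW : q ᵥ* W = 0) (hW : W.rank = Fintype.card m) :
    V * (W * (V * W)⁻¹) = 1 := by
  have hu : u ≠ 0 := by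
    rintro rfl
    simp at hqu
  have hinj : Function.Injective (V * W).mulVec := by
    refine (injective_iff_map_eq_zero (V * W).mulVecLin).2 fun x hx => ?_
    rw [mulVecLin_apply, ← mulVec_mulVec] at hx
    obtain ⟨c, hc⟩ := exists_eq_smul_of_mulVec_eq_zero hV hu hVu hx
    have hqWx : q ⬝ᵥ W *ᵥ x = 0 := by rw [dotProduct_mulVec, hqW, zero_dotProduct]
    rw [hc, dotProduct_smul, hqu, smul_eq_mul, mul_one] at hqWx
    rw [hqWx, zero_smul] at hc
    exact eq_zero_of_mulVec_eq_zero_of_rank_eq_card hW hc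
  have hunit : IsUnit (V * W) := mulVec_injective_iff_isUnit.1 hinj
  rw [← Matrix.mul_assoc, mul_nonsing_inv _ ((isUnit_iff_isUnit_det _).1 hunit)]

end Matrix

/-- For two normalized weighting vectors `q₁, q₂` with associated
generalized inverses `V₁⁺ = W₁(VW₁)⁻¹` and `V₂⁺ = W₂(VW₂)⁻¹` of the same
spanning-tree incidence matrix `V`, one has `q₁ᵀV₂⁺ = −q₂ᵀV₁⁺`. -/
theorem stmt15 (N : ℕ) (hN : 2 ≤ N)
    (V : Matrix (Fin (N - 1)) (Fin N) ℝ)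
    (hV1 : V.mulVec (fun _ => (1 : ℝ)) = 0) (hV2 : V.rank = N - 1)
    (q1 q2 : Fin N → ℝ)
    (hq1 : q1 ⬝ᵥ (fun _ => (1 : ℝ)) = 1) (hq2 : q2 ⬝ᵥ (fun _ => (1 : ℝ)) = 1)
    (W1 W2 : Matrix (Fin N) (Fin (N - 1)) ℝ)
    (hW1 : Matrix.vecMul q1 W1 = 0) (hW2 : Matrix.vecMul q2 W2 = 0)
    (hr1 : W1.rank = N - 1) (hr2 : W2.rank = N - 1) :
    Matrix.vecMul q1 (W2 * (V * W2)⁻¹) = -Matrix.vecMul q2 (W1 * (V * W1)⁻¹) := by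
  have hV : V.rank + 1 = Fintype.card (Fin N) := by
    rw [Fintype.card_fin]
    omega
  have h1 := mul_mul_inv_mul_eq_one hV hV1 hq1 hW1 (by simpa using hr1)
  have h2 := mul_mul_inv_mul_eq_one hV hV1 hq2 hW2 (by simpa using hr2)
  have hz1 : q1 ᵥ* (W1 * (V * W1)⁻¹) = 0 := by rw [← vecMul_vecMul, hW1, zero_vecMul]
  have hz2 : q2 ᵥ* (W2 * (V * W2)⁻¹) = 0 := by rw [← vecMul_vecMul, hW2, zero_vecMul]
  generalize W1 * (V * W1)⁻¹ = P1 at *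
  generalize W2 * (V * W2)⁻¹ = P2 at *
  have hu : (fun _ => 1 : Fin N → ℝ) ≠ 0 := fun h => by
    rw [h, dotProduct_zero] at hq1
    exact zero_ne_one hq1
  refine dotProduct_eq _ _ fun x => ?_
  obtain ⟨c, hc⟩ := exists_eq_smul_of_mulVec_eq_zero (x := (P2 - P1) *ᵥ x) hV hu hV1
    (by rw [mulVec_mulVec, Matrix.mul_sub, h1, h2, sub_self, zero_mulVec])
  have hc1 := congrArg (q1 ⬝ᵥ ·) hc
  have hc2 := congrArg (q2 ⬝ᵥ ·) hc
  simp only [dotProduct_mulVec, vecMul_sub, hz1, hz2, dotProduct_smul, hq1, hq2,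
    sub_zero, zero_sub] at hc1 hc2
  rw [hc1, hc2]
end

section
/- Let N ≥ 2. Let V ∈ ℝ^{(N−1)×N} satisfy V𝟙_N = 0 and rank V = N−1. Let q₁, q₂ ∈ ℝ^N satisfy q₁ᵀ𝟙_N = 1 and q₂ᵀ𝟙_N = 1, and let W₂ ∈ ℝ^{N×(N−1)} satisfy q₂ᵀW₂ = 0 and rank W₂ = N−1; set V₂⁺ := W₂(VW₂)⁻¹. Then for every x ∈ ℝ^N, q₁ᵀx = q₁ᵀV₂⁺(Vx) + q₂ᵀx. -/
open Matrix

theorem mulVec_injective_of_rank_eq_card {m n K : Type*} [Fintype m] [Fintype n] [Field K]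
    (A : Matrix m n K) (hA : A.rank = Fintype.card n) : Function.Injective A.mulVec := by
  have h := A.mulVecLin.finrank_range_add_finrank_ker
  rw [Module.finrank_fintype_fun_eq_card] at h
  change A.rank + _ = _ at h
  have hker : LinearMap.ker A.mulVecLin = ⊥ := Submodule.finrank_eq_zero.mp (by omega)
  exact LinearMap.ker_eq_bot.mp hker

theorem exists_smul_eq_of_mulVec_eq_zero {m n K : Type*} [Fintype m] [Fintype n] [Field K]
    (A : Matrix m n K) (hA : A.rank + 1 = Fintype.card n) {v : n → K} (hv : v ≠ 0)
    (hAv : A *ᵥ v = 0) {u : n → K} (hu : A *ᵥ u = 0) : ∃ c : K, c • v = u := by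
  have h := A.mulVecLin.finrank_range_add_finrank_ker
  rw [Module.finrank_fintype_fun_eq_card] at h
  change A.rank + _ = _ at h
  have hker : Module.finrank K (LinearMap.ker A.mulVecLin) = 1 := by omega
  obtain ⟨c, hc⟩ := (finrank_eq_one_iff_of_nonzero'
    (⟨v, hAv⟩ : LinearMap.ker A.mulVecLin) (fun h => hv (congrArg Subtype.val h))).mp hker ⟨u, hu⟩
  exact ⟨c, congrArg Subtype.val hc⟩

/-- With `V₂⁺ = W₂(VW₂)⁻¹` the generalized inverse of the
spanning-tree incidence matrix `V` induced by `q₂`, for every `x`: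
`q₁ᵀx = q₁ᵀV₂⁺(Vx) + q₂ᵀx`. -/
theorem stmt16 (N : ℕ) (hN : 2 ≤ N)
    (V : Matrix (Fin (N - 1)) (Fin N) ℝ)
    (hV1 : V.mulVec (fun _ => (1 : ℝ)) = 0) (hV2 : V.rank = N - 1)
    (q1 q2 : Fin N → ℝ)
    (hq1 : q1 ⬝ᵥ (fun _ => (1 : ℝ)) = 1) (hq2 : q2 ⬝ᵥ (fun _ => (1 : ℝ)) = 1)
    (W2 : Matrix (Fin N) (Fin (N - 1)) ℝ)
    (hW2 : Matrix.vecMul q2 W2 = 0) (hr2 : W2.rank = N - 1) :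
    ∀ x : Fin N → ℝ,
      q1 ⬝ᵥ x = q1 ⬝ᵥ (W2 * (V * W2)⁻¹).mulVec (V.mulVec x) + q2 ⬝ᵥ x := by
  have hone : (fun _ => (1 : ℝ) : Fin N → ℝ) ≠ 0 := by
    intro h
    simp [h] at hq2
  have hspan {u : Fin N → ℝ} (hu : V *ᵥ u = 0) : (q2 ⬝ᵥ u) • (fun _ => (1 : ℝ)) = u := by
    obtain ⟨c, rfl⟩ := exists_smul_eq_of_mulVec_eq_zero V
      (by rw [Fintype.card_fin]; omega) hone hV1 hu
    rw [dotProduct_smul, hq2, smul_eq_mul, mul_one]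
  have hq2W (y : Fin (N - 1) → ℝ) : q2 ⬝ᵥ (W2 *ᵥ y) = 0 := by
    rw [dotProduct_mulVec, hW2, zero_dotProduct]
  have hinj : Function.Injective W2.mulVec :=
    mulVec_injective_of_rank_eq_card W2 (by rw [Fintype.card_fin, hr2])
  have hunit : IsUnit (V * W2) := by
    rw [← mulVec_injective_iff_isUnit]
    refine (injective_iff_map_eq_zero (V * W2).mulVecLin).mpr fun y hy => ?_
    rw [mulVecLin_apply, ← mulVec_mulVec] at hy
    have hWy := hspan hy
    rw [hq2W, zero_smul] at hWy
    exact hinj (by rw [← hWy, mulVec_zero])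
  intro x
  have hVx : V *ᵥ (x - (W2 * (V * W2)⁻¹) *ᵥ (V *ᵥ x)) = 0 := by
    rw [mulVec_sub, mulVec_mulVec (V *ᵥ x), ← Matrix.mul_assoc,
      mul_nonsing_inv _ ((isUnit_iff_isUnit_det _).mp hunit), one_mulVec, sub_self]
  have h := congrArg (q1 ⬝ᵥ ·) (hspan hVx)
  simp only [dotProduct_smul, dotProduct_sub, hq1, ← mulVec_mulVec, hq2W, smul_eq_mul] at h
  simp only [← mulVec_mulVec]
  linarith
end
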